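/- For every ε > 0 there is no sequence of Delzant polygons P₀, P₁, P₂, P₃, P₄ with P₀ = Δ = conv{(0,0),(1,0),(0,1)} such that for each i = 0, 1, 2, 3 the polygon P_{i+1} is an ε-corner chop of P_i at some vertex. That is, the standard triangle does not admit four successive corner chops of equal size. -/

import Mathlib

open MeasureTheory

noncomputable section

/-- The real vector in `ℝ²` corresponding to an integer vector in `ℤ²`. -/
def intVec (u : ℤ × ℤ) : ℝ × ℝ := ((u.1 : ℝ), (u.2 : ℝ))

/-- `RatLenIs w ℓ` : the vector `w` lies on a line of rational slope and has rational
length `ℓ`, i.e. `ℓ > 0` and `w / ℓ` is a primitive vector of `ℤ²` (coprime coordinates). -/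
def RatLenIs (w : ℝ × ℝ) (ℓ : ℝ) : Prop :=
  0 < ℓ ∧ ∃ u : ℤ × ℤ, IsCoprime u.1 u.2 ∧ w = ℓ • intVec u

/-- The closed segment `[a, b]`, with `a ≠ b`, is an edge (a one-dimensional face,
i.e. an extreme subset which is a nondegenerate segment) of the convex set `P`. -/
def IsEdge (P : Set (ℝ × ℝ)) (a b : ℝ × ℝ) : Prop :=
  a ≠ b ∧ IsExtreme ℝ P (segment ℝ a b)

/-- `u ∈ ℤ²` is a direction of an edge of `P` emanating from the vertex `v`. -/
def EdgeDir (P : Set (ℝ × ℝ)) (v : ℝ × ℝ) (u : ℤ × ℤ) : Prop :=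
  ∃ w, IsEdge P v w ∧ ∃ ℓ : ℝ, 0 < ℓ ∧ w - v = ℓ • intVec u

/-- The Delzant condition at the vertex `v` of `P`, witnessed by `u₁, u₂` : these are the
primitive integer vectors pointing from `v` along the two edges of `P` incident to `v`,
and they form a `ℤ`-basis of `ℤ²` (their determinant is `±1`). -/
def DelzantAt (P : Set (ℝ × ℝ)) (v : ℝ × ℝ) (u₁ u₂ : ℤ × ℤ) : Prop :=
  IsCoprime u₁.1 u₁.2 ∧ IsCoprime u₂.1 u₂.2 ∧
  EdgeDir P v u₁ ∧ EdgeDir P v u₂ ∧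
  (u₁.1 * u₂.2 - u₁.2 * u₂.1 = 1 ∨ u₁.1 * u₂.2 - u₁.2 * u₂.1 = -1) ∧
  ∀ u : ℤ × ℤ, IsCoprime u.1 u.2 → EdgeDir P v u → u = u₁ ∨ u = u₂

/-- `V` is the (finite) vertex set of a Delzant polygon `P = conv V ⊆ ℝ²`: `P` is a compact
convex polygon with nonempty interior, its set of vertices (extreme points) is exactly `V`,
and at each vertex the primitive directions of the two incident edges form a `ℤ`-basis of
`ℤ²`; in particular every edge has rational slope. -/
def IsDelzantPolygon (V : Set (ℝ × ℝ)) : Prop :=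
  V.Finite ∧ (interior (convexHull ℝ V)).Nonempty ∧
  Set.extremePoints ℝ (convexHull ℝ V) = V ∧
  ∀ v ∈ V, ∃ u₁ u₂ : ℤ × ℤ, DelzantAt (convexHull ℝ V) v u₁ u₂

/-- The new vertex set `(V ∖ {v}) ∪ {v + ε·u₁, v + ε·u₂}` of the `ε`-corner chop at `v`
of the polygon with vertex set `V`. -/
def chopSet (V : Set (ℝ × ℝ)) (v : ℝ × ℝ) (u₁ u₂ : ℤ × ℤ) (ε : ℝ) : Set (ℝ × ℝ) :=
  (V \ {v}) ∪ {v + ε • intVec u₁, v + ε • intVec u₂}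

/-- The polygon with vertex set `W` is an `ε`-corner chop of the Delzant polygon with
vertex set `V` at some vertex `v` whose two incident edges both have rational length
strictly greater than `ε`. -/
def IsCornerChop (V W : Set (ℝ × ℝ)) (ε : ℝ) : Prop :=
  0 < ε ∧ ∃ v ∈ V, ∃ u₁ u₂ : ℤ × ℤ,
    DelzantAt (convexHull ℝ V) v u₁ u₂ ∧
    (∀ w ℓ, IsEdge (convexHull ℝ V) v w → RatLenIs (w - v) ℓ → ε < ℓ) ∧
    convexHull ℝ W = convexHull ℝ (chopSet V v u₁ u₂ ε)

/-- The vertex set of the standard triangle `Δ = conv {(0,0), (1,0), (0,1)}`. -/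
def stdTri : Set (ℝ × ℝ) := {(0, 0), (1, 0), (0, 1)}

open Set

/-- The planar determinant `det (a, b)` of two vectors. -/
def planarDet (a b : ℝ × ℝ) : ℝ := a.1 * b.2 - a.2 * b.1

lemma convex_le_planarDet (a v : ℝ × ℝ) (r : ℝ) : Convex ℝ {x | r ≤ planarDet a (x - v)} := by
  intro x hx y hy s t hs ht hst
  simp only [mem_ofPred_eq, planarDet, Prod.fst_sub, Prod.snd_sub, Prod.fst_add, Prod.snd_add,
    Prod.smul_fst, Prod.smul_snd, smul_eq_mul] at *
  obtain rfl : t = 1 - s := by linarith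
  nlinarith [mul_le_mul_of_nonneg_left hx hs, mul_le_mul_of_nonneg_left hy ht]

lemma IsEdge.symm {P : Set (ℝ × ℝ)} {a b : ℝ × ℝ} (h : IsEdge P a b) : IsEdge P b a :=
  ⟨h.1.symm, by rw [segment_symm]; exact h.2⟩

lemma RatLenIs.sub_comm {a b : ℝ × ℝ} {l : ℝ} (h : RatLenIs (a - b) l) : RatLenIs (b - a) l := by
  obtain ⟨hl, u, hu, he⟩ := h
  refine ⟨hl, -u, IsCoprime.neg_neg hu, ?_⟩
  rw [← neg_sub, he]
  ext <;> simp [intVec]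

lemma IsEdge.left_mem_extremePoints {P : Set (ℝ × ℝ)} {a b : ℝ × ℝ} (h : IsEdge P a b) :
    a ∈ P.extremePoints ℝ := by
  refine h.2.extremePoints_subset_extremePoints ⟨left_mem_segment ℝ a b, ?_⟩
  rintro x ⟨s₁, t₁, hs₁, ht₁, h₁, rfl⟩ y ⟨s₂, t₂, hs₂, ht₂, h₂, rfl⟩ ⟨p, q, hp, hq, hpq, he⟩
  have hab : b - a ≠ 0 := sub_ne_zero.2 h.1.symm
  have hz : (p * t₁ + q * t₂) • (b - a) = 0 := by
    obtain rfl : s₁ = 1 - t₁ := by linarith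
    obtain rfl : s₂ = 1 - t₂ := by linarith
    obtain rfl : p = 1 - q := by linarith
    rw [← sub_eq_zero.2 he]
    module
  have h0 := (smul_eq_zero.1 hz).resolve_right hab
  have : t₁ = 0 := by nlinarith [mul_nonneg hq.le ht₂, mul_nonneg hp.le ht₁]
  subst this
  obtain rfl : s₁ = 1 := by linarith
  simp

/-- A point of `P` on the line spanned by an edge lies on that edge. -/
lemma IsEdge.mem_segment_of_line {P : Set (ℝ × ℝ)} {v w : ℝ × ℝ} (h : IsEdge P v w) {t : ℝ}
    (ht : v + t • (w - v) ∈ P) : v + t • (w - v) ∈ segment ℝ v w := by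
  have hv : v ∈ P := h.2.subset (left_mem_segment ℝ v w)
  have hw : w ∈ P := h.2.subset (right_mem_segment ℝ v w)
  rcases lt_or_ge t 0 with h0 | h0
  · have h1 : 0 < 1 - t := by linarith
    refine h.2.left_mem_of_mem_openSegment ht hw (left_mem_segment ℝ v w)
      ⟨1 / (1 - t), -t / (1 - t), by positivity, div_pos (by linarith) h1, ?_, ?_⟩
    · field_simp; ring
    · ext <;> simp <;> field_simp <;> ring
  rcases le_or_gt t 1 with h1 | h1
  · exact ⟨1 - t, t, by linarith, h0, by ring, by module⟩
  · have h2 : 0 < t := by linarith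
    refine h.2.left_mem_of_mem_openSegment ht hv (right_mem_segment ℝ v w)
      ⟨1 / t, 1 - 1 / t, by positivity, ?_, by ring, ?_⟩
    · rw [sub_pos, div_lt_one h2]; exact h1
    · ext <;> simp <;> field_simp <;> ring

/-- A convex set lies on one side of the line spanned by any of its edges. -/
lemma IsEdge.planarDet_mul_nonneg {P : Set (ℝ × ℝ)} (hP : Convex ℝ P) {v w x y : ℝ × ℝ}
    (h : IsEdge P v w) (hx : x ∈ P) (hy : y ∈ P) :
    0 ≤ planarDet (w - v) (x - v) * planarDet (w - v) (y - v) := by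
  by_contra! hneg
  wlog hpos : planarDet (w - v) (x - v) < 0 generalizing x y
  · refine this hy hx (by rwa [mul_comm]) ?_
    by_contra! hc
    exact absurd (mul_nonneg (not_lt.1 hpos) hc) (not_le.2 hneg)
  have hypos : 0 < planarDet (w - v) (y - v) := by
    by_contra! hc
    exact absurd (mul_nonneg_of_nonpos_of_nonpos hpos.le hc) (not_le.2 hneg)
  set c := planarDet (w - v) (x - v) with hc
  set d := planarDet (w - v) (y - v) with hd
  have hdc : 0 < d - c := by linarith
  set z := (d / (d - c)) • x + (-c / (d - c)) • y with hz
  have hzo : z ∈ openSegment ℝ x y :=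
    ⟨_, _, div_pos hypos hdc, div_pos (by linarith) hdc, by field_simp; ring, rfl⟩
  have hzP : z ∈ P := hP.openSegment_subset hx hy hzo
  have hz0 : planarDet (w - v) (z - v) = 0 := by
    have : planarDet (w - v) (z - v) = (d / (d - c)) * c + (-c / (d - c)) * d := by
      rw [hz, hc, hd]
      have e : d / (d - c) = 1 - (-c / (d - c)) := by field_simp; ring
      rw [← hc, ← hd, e]
      generalize -c / (d - c) = r
      rw [hc, hd]
      simp only [planarDet, Prod.fst_sub, Prod.snd_sub, Prod.fst_add, Prod.snd_add,
        Prod.smul_fst, Prod.smul_snd, smul_eq_mul]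
      ring
    rw [this]; field_simp; ring
  obtain ⟨t, ht⟩ : ∃ t : ℝ, z = v + t • (w - v) := by
    have hN : (w - v).1 ^ 2 + (w - v).2 ^ 2 ≠ 0 := by
      intro h0
      have h1 : (w - v).1 = 0 := by nlinarith [sq_nonneg (w - v).1, sq_nonneg (w - v).2]
      have h2 : (w - v).2 = 0 := by nlinarith [sq_nonneg (w - v).1, sq_nonneg (w - v).2]
      exact h.1.symm (sub_eq_zero.1 (Prod.ext h1 h2))
    refine ⟨((w - v).1 * (z - v).1 + (w - v).2 * (z - v).2) /
      ((w - v).1 ^ 2 + (w - v).2 ^ 2), ?_⟩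
    rw [← sub_eq_iff_eq_add']
    unfold planarDet at hz0
    generalize z - v = b at *
    generalize w - v = a at *
    ext
    · simp only [Prod.smul_fst, smul_eq_mul]
      field_simp
      linear_combination -a.2 * hz0
    · simp only [Prod.smul_snd, smul_eq_mul]
      field_simp
      linear_combination a.1 * hz0
  have hzs : z ∈ segment ℝ v w := by
    rw [ht]; exact h.mem_segment_of_line (ht ▸ hzP)
  obtain ⟨s, r, -, -, hsr, hxs⟩ := h.2.left_mem_of_mem_openSegment hx hy hzs hzo
  refine hpos.ne ?_
  obtain rfl : s = 1 - r := by linarith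
  rw [hc, ← hxs]
  simp only [planarDet, Prod.fst_sub, Prod.snd_sub, Prod.fst_add, Prod.snd_add,
    Prod.smul_fst, Prod.smul_snd, smul_eq_mul]
  ring

/-- The vertices in `V` of the polygon `conv V` that are on no edge of rational length `ε`. -/
def freeVertices (V : Set (ℝ × ℝ)) (ε : ℝ) : Set (ℝ × ℝ) :=
  {v ∈ V | ∀ w, IsEdge (convexHull ℝ V) v w → ¬ RatLenIs (w - v) ε}

lemma DelzantAt.planarDet_mul_self {P : Set (ℝ × ℝ)} {v : ℝ × ℝ} {u₁ u₂ : ℤ × ℤ}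
    (h : DelzantAt P v u₁ u₂) :
    planarDet (intVec u₁) (intVec u₂) * planarDet (intVec u₁) (intVec u₂) = 1 := by
  have : planarDet (intVec u₁) (intVec u₂) = ((u₁.1 * u₂.2 - u₁.2 * u₂.1 : ℤ) : ℝ) := by
    simp [planarDet, intVec]
  rcases h.2.2.2.2.1 with h | h <;> rw [this, h] <;> norm_num

/-- The coordinates of `x - v` in the basis of primitive edge directions at a vertex `v` are
nonnegative on the polygon. -/
lemma DelzantAt.exists_coords {P : Set (ℝ × ℝ)} (hP : Convex ℝ P) {v : ℝ × ℝ} {u₁ u₂ : ℤ × ℤ}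
    (h : DelzantAt P v u₁ u₂) {x : ℝ × ℝ} (hx : x ∈ P) :
    ∃ α β : ℝ, 0 ≤ α ∧ 0 ≤ β ∧ x = v + α • intVec u₁ + β • intVec u₂ := by
  have hD2 := h.planarDet_mul_self
  obtain ⟨-, -, ⟨w₁, e₁, l₁, hl₁, hw₁⟩, ⟨w₂, e₂, l₂, hl₂, hw₂⟩, -, -⟩ := h
  set D : ℝ := planarDet (intVec u₁) (intVec u₂) with hD
  have h₁ := e₁.planarDet_mul_nonneg hP hx (e₂.2.subset (right_mem_segment ℝ _ _))
  have h₂ := e₂.planarDet_mul_nonneg hP hx (e₁.2.subset (right_mem_segment ℝ _ _))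
  rw [hw₁, hw₂] at h₁ h₂
  refine ⟨D * planarDet (x - v) (intVec u₂), D * planarDet (intVec u₁) (x - v), ?_, ?_, ?_⟩
  · have : 0 ≤ (l₂ * l₂ * l₁) * (D * planarDet (x - v) (intVec u₂)) := by
      convert h₂ using 1
      simp only [hD, planarDet, Prod.smul_fst, Prod.smul_snd, smul_eq_mul]
      ring
    exact nonneg_of_mul_nonneg_right this (by positivity)
  · have : 0 ≤ (l₁ * l₁ * l₂) * (D * planarDet (intVec u₁) (x - v)) := by
      convert h₁ using 1
      simp only [hD, planarDet, Prod.smul_fst, Prod.smul_snd, smul_eq_mul]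
      ring
    exact nonneg_of_mul_nonneg_right this (by positivity)
  · have e : ∀ a b : ℝ × ℝ, planarDet a b = a.1 * b.2 - a.2 * b.1 := fun _ _ => rfl
    rw [e] at hD
    ext
    · simp only [e, Prod.fst_sub, Prod.snd_sub, Prod.fst_add, Prod.smul_fst, smul_eq_mul]
      linear_combination (v.1 - x.1) * hD2 + D * (x.1 - v.1) * hD
    · simp only [e, Prod.fst_sub, Prod.snd_sub, Prod.snd_add, Prod.smul_snd, smul_eq_mul]
      linear_combination (v.2 - x.2) * hD2 + D * (x.2 - v.2) * hD

/-- The new edge of a corner chop. -/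
lemma DelzantAt.isEdge_chopSet {V : Set (ℝ × ℝ)} {ε : ℝ} (hε : 0 < ε) {v : ℝ × ℝ}
    {u₁ u₂ : ℤ × ℤ} (h : DelzantAt (convexHull ℝ V) v u₁ u₂)
    (hV : (convexHull ℝ V).extremePoints ℝ = V) (hv : v ∈ V)
    (h₁ : v + ε • intVec u₁ ∈ convexHull ℝ V) (h₂ : v + ε • intVec u₂ ∈ convexHull ℝ V) :
    IsEdge (convexHull ℝ (chopSet V v u₁ u₂ ε)) (v + ε • intVec u₁) (v + ε • intVec u₂) := by
  have hD2 := h.planarDet_mul_self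
  set D : ℝ := planarDet (intVec u₁) (intVec u₂) with hD
  have hP := convex_convexHull ℝ V
  have hcoord : ∀ α β : ℝ, planarDet (D • (intVec u₁ - intVec u₂))
      (v + α • intVec u₁ + β • intVec u₂ - v) = α + β := by
    intro α β
    have e : ∀ a b : ℝ × ℝ, planarDet a b = a.1 * b.2 - a.2 * b.1 := fun _ _ => rfl
    rw [e] at hD
    simp only [e, Prod.fst_sub, Prod.snd_sub, Prod.fst_add, Prod.snd_add, Prod.smul_fst,
      Prod.smul_snd, smul_eq_mul]
    linear_combination (α + β) * hD2 - D * (α + β) * hD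
  have hsub : convexHull ℝ (chopSet V v u₁ u₂ ε) ⊆ convexHull ℝ V := by
    refine convexHull_min ?_ hP
    rintro x (hx | rfl | rfl)
    exacts [subset_convexHull ℝ V hx.1, h₁, h₂]
  have hge : convexHull ℝ (chopSet V v u₁ u₂ ε) ⊆
      {x | ε ≤ planarDet (D • (intVec u₁ - intVec u₂)) (x - v)} := by
    refine convexHull_min ?_ (convex_le_planarDet _ _ _)
    rintro x (hx | rfl | rfl)
    · obtain ⟨α, β, hα, hβ, hxe⟩ := h.exists_coords hP (subset_convexHull ℝ V hx.1)
      have hxext : x ∈ (convexHull ℝ V).extremePoints ℝ := by rw [hV]; exact hx.1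
      rw [mem_ofPred_eq, hxe, hcoord]
      by_contra! hlt
      have hpos : 0 < α + β := by
        refine lt_of_le_of_ne (by positivity) fun h0 => hx.2 ?_
        have hα0 : α = 0 := by linarith
        have hβ0 : β = 0 := by linarith
        rw [mem_singleton_iff, hxe, hα0, hβ0]
        simp
      have hq : (α / (α + β)) • (v + ε • intVec u₁) + (β / (α + β)) • (v + ε • intVec u₂) ∈
          convexHull ℝ V :=
        hP h₁ h₂ (by positivity) (by positivity) (by field_simp)
      refine hx.2 (hxext.2 (subset_convexHull ℝ V hv) hq
        ⟨1 - (α + β) / ε, (α + β) / ε, ?_, by positivity, by ring, ?_⟩).symm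
      · rw [sub_pos, div_lt_one hε]; exact hlt
      · rw [hxe]
        ext <;> simp <;> field_simp <;> ring
    · simpa using (hcoord ε 0).ge
    · simpa using (hcoord 0 ε).ge
  refine ⟨fun he => ?_, ?_, ?_⟩
  · have he' : intVec u₁ = intVec u₂ := smul_right_injective _ hε.ne' (add_left_cancel he)
    have : D = 0 := by rw [hD, he']; unfold planarDet; ring
    rw [this] at hD2
    norm_num at hD2
  · exact (convex_convexHull ℝ _).segment_subset
      (subset_convexHull ℝ _ (Or.inr (Or.inl rfl))) (subset_convexHull ℝ _ (Or.inr (Or.inr rfl)))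
  · rintro x hx y hy z ⟨s, t, hs, ht, hst, rfl⟩ ⟨p, q, hp, hq, hpq, hz⟩
    have hxge := hge hx
    have hyge := hge hy
    obtain ⟨α, β, hα, hβ, rfl⟩ := h.exists_coords hP (hsub hx)
    obtain ⟨γ, δ, hγ, hδ, rfl⟩ := h.exists_coords hP (hsub hy)
    rw [mem_ofPred_eq, hcoord] at hxge hyge
    have hsum : p * (α + β) + q * (γ + δ) = ε := by
      have e₁ : s • (v + ε • intVec u₁) + t • (v + ε • intVec u₂) =
          v + (s * ε) • intVec u₁ + (t * ε) • intVec u₂ := by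
        obtain rfl : s = 1 - t := by linarith
        module
      have e₂ : p • (v + α • intVec u₁ + β • intVec u₂) +
          q • (v + γ • intVec u₁ + δ • intVec u₂) =
          v + (p * α + q * γ) • intVec u₁ + (p * β + q * δ) • intVec u₂ := by
        obtain rfl : p = 1 - q := by linarith
        module
      rw [e₁, e₂] at hz
      have := congrArg (fun x => planarDet (D • (intVec u₁ - intVec u₂)) (x - v)) hz
      simp only [hcoord] at this
      linear_combination this + ε * hst
    have hαβ : α + β = ε := by
      obtain rfl : p = 1 - q := by linarith
      nlinarith [mul_nonneg hq.le (sub_nonneg.2 hyge)]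
    refine ⟨α / ε, β / ε, by positivity, by positivity, ?_, ?_⟩
    · rw [← add_div, hαβ, div_self hε.ne']
    · obtain rfl : β = ε - α := by linarith
      ext <;> simp <;> field_simp <;> ring

/-- A corner chop uses up a free vertex and creates no new ones. -/
lemma IsCornerChop.exists_freeVertices_subset {V W : Set (ℝ × ℝ)} {ε : ℝ}
    (h : IsCornerChop V W ε) (hV : (convexHull ℝ V).extremePoints ℝ = V)
    (hW : (convexHull ℝ W).extremePoints ℝ = W) :
    ∃ v ∈ freeVertices V ε, freeVertices W ε ⊆ freeVertices V ε \ {v} := by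
  obtain ⟨hε, v, hv, u₁, u₂, hD, hlen, hWV⟩ := h
  have hmem : ∀ u : ℤ × ℤ, IsCoprime u.1 u.2 → EdgeDir (convexHull ℝ V) v u →
      v + ε • intVec u ∈ convexHull ℝ V := by
    rintro u hu ⟨w, hw, l, hl, hwl⟩
    have hlt := hlen w l hw ⟨hl, u, hu, hwl⟩
    refine hw.2.subset ⟨1 - ε / l, ε / l, ?_, by positivity, by ring, ?_⟩
    · rw [sub_nonneg, div_le_one hl]; exact hlt.le
    · rw [← sub_add_cancel w v, hwl]
      ext <;> simp <;> field_simp <;> ring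
  have h₁ := hmem u₁ hD.1 hD.2.2.1
  have h₂ := hmem u₂ hD.2.1 hD.2.2.2.1
  have hedge := hD.isEdge_chopSet hε hV hv h₁ h₂
  have hrat : RatLenIs (v + ε • intVec u₂ - (v + ε • intVec u₁)) ε := by
    refine ⟨hε, u₂ - u₁, ?_, ?_⟩
    · rcases hD.2.2.2.2.1 with h | h
      · exact ⟨-u₁.2, u₁.1, by simp only [Prod.fst_sub, Prod.snd_sub]; linear_combination h⟩
      · exact ⟨u₁.2, -u₁.1, by simp only [Prod.fst_sub, Prod.snd_sub]; linear_combination -h⟩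
    · ext <;> simp [intVec] <;> ring
  rw [← hWV] at hedge
  have hsub : convexHull ℝ W ⊆ convexHull ℝ V := by
    rw [hWV]
    refine convexHull_min ?_ (convex_convexHull ℝ V)
    rintro x (hx | rfl | rfl)
    exacts [subset_convexHull ℝ V hx.1, h₁, h₂]
  have hkeep : ∀ x ∈ V, x ≠ v → x ∈ convexHull ℝ W := by
    intro x hx hxv
    rw [hWV]
    exact subset_convexHull ℝ _ (Or.inl ⟨hx, hxv⟩)
  refine ⟨v, ⟨hv, fun w hw hr => lt_irrefl _ (hlen w ε hw hr)⟩, ?_⟩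
  rintro w ⟨hw, hfree⟩
  have hwc : w ∈ chopSet V v u₁ u₂ ε := by
    rw [← hW, hWV] at hw
    exact extremePoints_convexHull_subset hw
  rcases hwc with hwc | rfl | rfl
  · refine ⟨⟨hwc.1, fun y hy hr => hfree y ⟨hy.1, hy.2.mono hsub ?_⟩ hr⟩, hwc.2⟩
    refine (convex_convexHull ℝ W).segment_subset (hkeep w hwc.1 hwc.2) (hkeep y ?_ ?_)
    · exact hV ▸ hy.symm.left_mem_extremePoints
    · rintro rfl
      exact lt_irrefl _ (hlen w ε hy.symm hr.sub_comm)
  · exact absurd hrat (hfree _ hedge)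
  · exact absurd hrat.sub_comm (hfree _ hedge.symm)

lemma IsCornerChop.ncard_freeVertices_lt {V W : Set (ℝ × ℝ)} {ε : ℝ} (h : IsCornerChop V W ε)
    (hfin : V.Finite) (hV : (convexHull ℝ V).extremePoints ℝ = V)
    (hW : (convexHull ℝ W).extremePoints ℝ = W) :
    (freeVertices W ε).ncard < (freeVertices V ε).ncard := by
  obtain ⟨v, hv, hsub⟩ := h.exists_freeVertices_subset hV hW
  exact ncard_lt_ncard ⟨fun x hx => (hsub hx).1, fun hc => (hsub (hc hv)).2 rfl⟩
    (hfin.subset fun x hx => hx.1)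

lemma extremePoints_convexHull_stdTri : (convexHull ℝ stdTri).extremePoints ℝ = stdTri := by
  refine extremePoints_convexHull_subset.antisymm fun v hv => ?_
  have hsub : convexHull ℝ stdTri ⊆ {x | 0 ≤ x.1 ∧ 0 ≤ x.2 ∧ x.1 + x.2 ≤ 1} := by
    refine convexHull_min ?_ ?_
    · rintro x (rfl | rfl | rfl) <;> norm_num
    · rintro x ⟨h₁, h₂, h₃⟩ y ⟨k₁, k₂, k₃⟩ s t hs ht hst
      refine ⟨?_, ?_, ?_⟩ <;>
        simp only [Prod.fst_add, Prod.snd_add, Prod.smul_fst, Prod.smul_snd, smul_eq_mul]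
      · positivity
      · positivity
      · nlinarith [mul_le_mul_of_nonneg_left h₃ hs, mul_le_mul_of_nonneg_left k₃ ht]
  refine ⟨subset_convexHull ℝ _ hv, fun x hx y hy ⟨s, t, hs, ht, hst, he⟩ => ?_⟩
  obtain ⟨h₁, h₂, h₃⟩ := hsub hx
  obtain ⟨k₁, k₂, k₃⟩ := hsub hy
  have e₁ := congrArg Prod.fst he
  have e₂ := congrArg Prod.snd he
  simp only [Prod.fst_add, Prod.snd_add, Prod.smul_fst, Prod.smul_snd, smul_eq_mul] at e₁ e₂
  have m₁ := mul_nonneg ht.le k₁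
  have m₂ := mul_nonneg ht.le k₂
  have m₃ := mul_nonneg ht.le (sub_nonneg.2 k₃)
  rcases hv with rfl | rfl | rfl <;> dsimp only at e₁ e₂
  · ext <;> dsimp only <;> nlinarith
  · have hx₂ : x.2 = 0 := by nlinarith
    have hx₁ : x.1 = 1 := by nlinarith
    exact Prod.ext hx₁ hx₂
  · have hx₁ : x.1 = 0 := by nlinarith
    have hx₂ : x.2 = 1 := by nlinarith
    exact Prod.ext hx₁ hx₂

/-- for every `ε > 0` there is no sequence of Delzant polygons
`P₀ = Δ, P₁, P₂, P₃, P₄` in which each `P_{i+1}` is an `ε`-corner chop of `P_i` at some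
vertex: the standard triangle does not admit four successive corner chops of equal
size. -/
theorem stdTri_no_four_chops (ε : ℝ) (hε : 0 < ε) :
    ¬ ∃ V₁ V₂ V₃ V₄ : Set (ℝ × ℝ),
      IsDelzantPolygon V₁ ∧ IsDelzantPolygon V₂ ∧ IsDelzantPolygon V₃ ∧
      IsDelzantPolygon V₄ ∧
      IsCornerChop stdTri V₁ ε ∧ IsCornerChop V₁ V₂ ε ∧ IsCornerChop V₂ V₃ ε ∧
      IsCornerChop V₃ V₄ ε := by
  rintro ⟨V₁, V₂, V₃, V₄, ⟨f₁, -, x₁, -⟩, ⟨f₂, -, x₂, -⟩, ⟨f₃, -, x₃, -⟩, ⟨-, -, x₄, -⟩,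
    c₁, c₂, c₃, c₄⟩
  have hfin : stdTri.Finite := by simp [stdTri]
  have n₁ := c₁.ncard_freeVertices_lt hfin extremePoints_convexHull_stdTri x₁
  have n₂ := c₂.ncard_freeVertices_lt f₁ x₁ x₂
  have n₃ := c₃.ncard_freeVertices_lt f₂ x₂ x₃
  have n₄ := c₄.ncard_freeVertices_lt f₃ x₃ x₄
  have hle : (freeVertices stdTri ε).ncard ≤ stdTri.ncard :=
    ncard_le_ncard (fun x hx => hx.1) hfin
  have h3 : stdTri.ncard ≤ 3 := by
    refine (ncard_insert_le _ _).trans (Nat.succ_le_succ ?_)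
    exact (ncard_insert_le _ _).trans (Nat.succ_le_succ (ncard_singleton _).le)
  omega
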